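/- Let α > 0 with α ∉ ℕ, and define σ_α = sup_{m ∈ ℕ, m ≥ 2} min( 2^{1−m}, (m−α)/(2^m−1), 2^{1−m}·α ). Then σ_α ∈ (0,1), and there exists a constant C > 0 such that for all integers N ≥ 2: | Σ_{n=1}^{N} ({n^α} − 1/2) | ≤ C·N^{1−σ_α}·log N. -/

import Mathlib

open Filter Topology Real

/-- The additive character `x ↦ exp (2πix)`. -/
noncomputable def unitExp (x : ℝ) : ℂ := Complex.exp ((2 * π * x : ℝ) * Complex.I)

theorem norm_unitExp (x : ℝ) : ‖unitExp x‖ = 1 := Complex.norm_exp_ofReal_mul_I _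

theorem unitExp_add (x y : ℝ) : unitExp (x + y) = unitExp x * unitExp y := by
  rw [unitExp, unitExp, unitExp, ← Complex.exp_add]
  congr 1
  push_cast
  ring

theorem unitExp_int (n : ℤ) : unitExp n = 1 := by
  rw [unitExp, Complex.exp_eq_one_iff]
  exact ⟨n, by push_cast; ring⟩

theorem conj_unitExp (x : ℝ) : (starRingEnd ℂ) (unitExp x) = unitExp (-x) := by
  rw [unitExp, unitExp, ← Complex.exp_conj, map_mul, Complex.conj_I, Complex.conj_ofReal]
  congr 1
  push_cast
  ring

theorem norm_sum_unitExp_le {ι : Type*} (s : Finset ι) (f : ι → ℝ) :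
    ‖∑ n ∈ s, unitExp (f n)‖ ≤ s.card := by
  simpa [norm_unitExp] using norm_sum_le s fun n ↦ unitExp (f n)

theorem two_mul_le_sin_pi_mul {θ d : ℝ} (hθ : 0 < θ) (h : θ ≤ d ∧ d ≤ 1 - θ) :
    2 * θ ≤ sin (π * d) := by
  have key : ∀ x : ℝ, θ ≤ x → x ≤ 1 / 2 → 2 * θ ≤ sin (π * x) := fun x h1 h2 ↦ by
    have := Real.mul_le_sin (x := π * x) (by have := pi_pos; nlinarith)
      (by have := pi_pos; nlinarith)
    have h3 : 2 / π * (π * x) = 2 * x := by field_simp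
    linarith
  rcases le_total d (1 / 2) with h1 | h1
  · exact key d h.1 h1
  · have := key (1 - d) (by linarith) (by linarith)
    rwa [mul_sub, mul_one, Real.sin_pi_sub] at this

theorem cot_mul_unitExp_sub_one {d : ℝ} (h : sin (π * d) ≠ 0) :
    (-1 / 2 - Complex.I / 2 * (cos (π * d) / sin (π * d) : ℝ)) * (unitExp d - 1) = 1 := by
  have h' : (sin (π * d) : ℂ) ≠ 0 := by exact_mod_cast h
  have e1 : unitExp d = (cos (π * d) + sin (π * d) * Complex.I) ^ 2 := by
    rw [unitExp, Complex.ofReal_cos, Complex.ofReal_sin, ← Complex.exp_mul_I, ← Complex.exp_nat_mul]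
    congr 1
    push_cast
    ring
  have e2 : (sin (π * d) : ℂ) ^ 2 + (cos (π * d) : ℂ) ^ 2 = 1 := by
    exact_mod_cast Real.sin_sq_add_cos_sq (π * d)
  rw [e1]
  push_cast at h' e2 ⊢
  generalize Complex.sin (π * d) = s at *
  generalize Complex.cos (π * d) = c at *
  have e3 : (c + s * Complex.I) ^ 2 - 1 = 2 * s * Complex.I * (c + s * Complex.I) := by
    linear_combination e2 - s ^ 2 * Complex.I_sq
  rw [e3]
  field_simp
  linear_combination (-(s * c * Complex.I + s ^ 2 + c ^ 2)) * Complex.I_sq + e2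

theorem kusmin_landau {f : ℕ → ℝ} {L : ℕ} {θ : ℝ} (hθ : 0 < θ)
    (hd : ∀ n < L, θ ≤ f (n + 1) - f n ∧ f (n + 1) - f n ≤ 1 - θ)
    (hmono : ∀ n, n + 1 < L → f (n + 1) - f n ≤ f (n + 2) - f (n + 1)) :
    ‖∑ n ∈ Finset.range L, unitExp (f n)‖ ≤ 2 / θ := by
  set d : ℕ → ℝ := fun n ↦ f (n + 1) - f n with hd_def
  set c : ℕ → ℝ := fun n ↦ cos (π * d n) / sin (π * d n) with hc
  set g : ℕ → ℂ := fun n ↦ -1 / 2 - Complex.I / 2 * (c n : ℝ) with hg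
  rcases Nat.eq_zero_or_pos L with rfl | hL
  · simp only [Finset.range_zero, Finset.sum_empty, norm_zero]
    positivity
  have hsin : ∀ n < L, 2 * θ ≤ sin (π * d n) := fun n hn ↦ two_mul_le_sin_pi_mul hθ (hd n hn)
  have hθ2 : θ ≤ 1 / 2 := by linarith [(hd 0 hL).1, (hd 0 hL).2]
  have hcb : ∀ n < L, |c n| ≤ 1 / (2 * θ) := fun n hn ↦ by
    have := hsin n hn
    rw [hc, abs_div, abs_of_pos (by linarith : 0 < sin (π * d n))]
    exact div_le_div₀ zero_le_one (abs_cos_le_one _) (by positivity) this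
  have hgb : ∀ n < L, ‖g n‖ ≤ 1 / 2 + 1 / (4 * θ) := fun n hn ↦ by
    have h1 : ‖g n‖ ≤ 1 / 2 + 1 / 2 * |c n| := by
      refine (norm_sub_le _ _).trans (le_of_eq ?_)
      simp
    have h2 := hcb n hn
    have h3 : 1 / (4 * θ) = 1 / 2 * (1 / (2 * θ)) := by field_simp; norm_num
    linarith
  have hstep : ∀ n < L, unitExp (f n) - g n * unitExp (f (n + 1)) = -(g n * unitExp (f n)) :=
    fun n hn ↦ by
      have h1 := cot_mul_unitExp_sub_one (d := d n) (by linarith [hsin n hn])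
      have h2 : unitExp (f (n + 1)) = unitExp (f n) * unitExp (d n) := by
        rw [← unitExp_add]; congr 1; simp [hd_def]
      rw [h2]
      linear_combination (-unitExp (f n)) * h1
  have hanti : ∀ n, n + 1 < L → c (n + 1) ≤ c n := fun n hn ↦ by
    have h1 := hsin n (by lia)
    have h2 := hsin (n + 1) hn
    have h3 : d n ≤ d (n + 1) := hmono n hn
    rw [hc]
    simp only
    rw [div_le_div_iff₀ (by linarith) (by linarith)]
    have h4 : 0 ≤ sin (π * d (n + 1) - π * d n) := by
      have := (hd n (by lia)).1
      have := (hd (n + 1) hn).2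
      have := pi_pos
      apply Real.sin_nonneg_of_nonneg_of_le_pi
      · nlinarith
      · have : d (n + 1) - d n ≤ 1 := by simp only [hd_def] at *; linarith
        nlinarith
    rw [Real.sin_sub] at h4
    linarith
  have key : ∀ m, m + 1 ≤ L → ‖∑ n ∈ Finset.range (m + 1), unitExp (f n) - g m * unitExp (f (m + 1))‖
      ≤ 1 / 2 + 1 / (4 * θ) + 1 / 2 * (c 0 - c m) := by
    intro m
    induction m with
    | zero =>
      intro h
      rw [Finset.sum_range_one, hstep 0 h, norm_neg, norm_mul, norm_unitExp]
      linarith [hgb 0 h]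
    | succ m ih =>
      intro h
      have h1 : ∑ n ∈ Finset.range (m + 1 + 1), unitExp (f n) - g (m + 1) * unitExp (f (m + 1 + 1))
          = (∑ n ∈ Finset.range (m + 1), unitExp (f n) - g m * unitExp (f (m + 1)))
            + (g m - g (m + 1)) * unitExp (f (m + 1)) := by
        rw [Finset.sum_range_succ, add_sub_assoc, hstep (m + 1) h]
        ring
      have h2 : ‖(g m - g (m + 1)) * unitExp (f (m + 1))‖ = 1 / 2 * (c m - c (m + 1)) := by
        have : g m - g (m + 1) = ((-(1 / 2 * (c m - c (m + 1))) : ℝ) : ℂ) * Complex.I := by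
          simp only [hg]; push_cast; ring
        rw [this, norm_mul, norm_mul, norm_unitExp, Complex.norm_I, Complex.norm_real, norm_neg,
          Real.norm_of_nonneg (by linarith [hanti m h])]
        ring
      rw [h1]
      refine (norm_add_le _ _).trans ?_
      linarith [ih (by lia)]
  obtain ⟨m, rfl⟩ : ∃ m, L = m + 1 := ⟨L - 1, by lia⟩
  have h1 := key m le_rfl
  have h2 := hgb m (by lia)
  have h3 := abs_le.1 (hcb 0 hL)
  have h4 := abs_le.1 (hcb m (by lia))
  have h5 := norm_le_norm_sub_add (∑ n ∈ Finset.range (m + 1), unitExp (f n))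
    (g m * unitExp (f (m + 1)))
  rw [norm_mul, norm_unitExp, mul_one] at h5
  have h6 : 1 ≤ 1 / (2 * θ) := by rw [le_div_iff₀ (by positivity)]; linarith
  have h7 : 1 / (4 * θ) = 1 / 2 * (1 / (2 * θ)) := by field_simp; norm_num
  have h8 : 2 / θ = 4 * (1 / (2 * θ)) := by field_simp; norm_num
  linarith

theorem exists_filter_range_eq_Ico {L : ℕ} {d : ℕ → ℝ} (hd : MonotoneOn d (Set.Iio L)) (J : Set ℝ)
    [DecidablePred (· ∈ J)] (hJ : J.OrdConnected) :
    ∃ a b, (Finset.range L).filter (fun n ↦ d n ∈ J) = Finset.Ico a b := by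
  set A := (Finset.range L).filter (fun n ↦ d n ∈ J) with hA
  rcases A.eq_empty_or_nonempty with h | h
  · exact ⟨0, 0, by simpa using h⟩
  · refine ⟨A.min' h, A.max' h + 1, Finset.ext fun n ↦ ⟨fun hn ↦ ?_, fun hn ↦ ?_⟩⟩
    · exact Finset.mem_Ico.2 ⟨A.min'_le n hn, Nat.lt_succ_of_le (A.le_max' n hn)⟩
    · rw [Finset.mem_Ico, Nat.lt_succ_iff] at hn
      obtain ⟨h1, h2⟩ := Finset.mem_filter.1 (A.min'_mem h)
      obtain ⟨h3, h4⟩ := Finset.mem_filter.1 (A.max'_mem h)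
      rw [Finset.mem_range] at h1 h3
      refine Finset.mem_filter.2 ⟨Finset.mem_range.2 (by lia), hJ.out h2 h4 ⟨?_, ?_⟩⟩
      · exact hd h1 (hn.2.trans_lt h3) hn.1
      · exact hd (hn.2.trans_lt h3) h3 hn.2

theorem mul_sub_le_sub_of_le_step {L : ℕ} {d : ℕ → ℝ} {lam : ℝ}
    (h : ∀ n < L, lam ≤ d (n + 1) - d n) {p q : ℕ} (hpq : p ≤ q) (hq : q ≤ L) :
    lam * (q - p) ≤ d q - d p := by
  induction q, hpq using Nat.le_induction with
  | base => simp
  | succ q _ ih =>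
    have := h q (by lia)
    have := ih (by lia)
    push_cast
    linarith

theorem card_filter_range_le {L : ℕ} {d : ℕ → ℝ} {lam θ : ℝ} (hlam : 0 < lam) (hθ : 0 ≤ θ)
    (h : ∀ n < L, lam ≤ d (n + 1) - d n) (J : Set ℝ) [DecidablePred (· ∈ J)]
    (hJ : J.OrdConnected) (hJθ : ∀ x ∈ J, ∀ y ∈ J, y - x ≤ θ) :
    (((Finset.range L).filter (fun n ↦ d n ∈ J)).card : ℝ) ≤ θ / lam + 1 := by
  have hmono : MonotoneOn d (Set.Iio L) := fun p _ q hq hpq ↦ by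
    have := mul_sub_le_sub_of_le_step h hpq (le_of_lt hq)
    have h2 : (p : ℝ) ≤ q := by exact_mod_cast hpq
    nlinarith
  obtain ⟨a, b, hab⟩ := exists_filter_range_eq_Ico hmono J hJ
  rw [hab, Nat.card_Ico]
  rcases lt_or_ge a b with hlt | hge
  · have ha : a ∈ Finset.Ico a b := by simp [hlt]
    have hb : b - 1 ∈ Finset.Ico a b := by simp; lia
    rw [← hab, Finset.mem_filter, Finset.mem_range] at ha hb
    have h1 := mul_sub_le_sub_of_le_step h (p := a) (q := b - 1) (by lia) (by lia)
    have h2 := hJθ _ ha.2 _ hb.2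
    rw [Nat.cast_sub (by lia)] at h1 ⊢
    push_cast at h1
    rw [← sub_le_iff_le_add, le_div_iff₀ hlam]
    linarith
  · rw [Nat.sub_eq_zero_of_le hge]
    push_cast
    positivity

theorem norm_sum_floor_fiber_le {f : ℕ → ℝ} {L : ℕ} {lam θ : ℝ} (hlam : 0 < lam) (hθ : 0 < θ)
    (h : ∀ n < L, lam ≤ (f (n + 1 + 1) - f (n + 1)) - (f (n + 1) - f n)) (ν : ℤ) :
    ‖∑ n ∈ (Finset.range L).filter (fun n ↦ ⌊f (n + 1) - f n⌋ = ν), unitExp (f n)‖ ≤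
      2 * (θ / lam + 1) + 2 / θ := by
  classical
  set d : ℕ → ℝ := fun n ↦ f (n + 1) - f n with hd
  have hmono : MonotoneOn d (Set.Iio L) := fun p _ q hq hpq ↦ by
    have := mul_sub_le_sub_of_le_step (d := d) h hpq (le_of_lt hq)
    have h2 : (p : ℝ) ≤ q := by exact_mod_cast hpq
    nlinarith
  have hJ1 : (Set.Ico (ν : ℝ) (ν + 1) ∩ Set.Iio (ν + θ)).OrdConnected := inferInstance
  have hJ2 : (Set.Ico (ν : ℝ) (ν + 1) ∩ Set.Ioi (ν + 1 - θ)).OrdConnected := inferInstance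
  have c1 := card_filter_range_le (d := d) hlam hθ.le h _ hJ1
    (fun x hx y hy ↦ by linarith [hx.1.1, Set.mem_Iio.1 hy.2])
  have c2 := card_filter_range_le (d := d) hlam hθ.le h _ hJ2
    (fun x hx y hy ↦ by linarith [hy.1.2, Set.mem_Ioi.1 hx.2])
  obtain ⟨a, b, hab⟩ := exists_filter_range_eq_Ico hmono (Set.Icc (ν + θ) (ν + 1 - θ))
    Set.ordConnected_Icc
  have hmid : ‖∑ n ∈ (Finset.range L).filter (fun n ↦ d n ∈ Set.Icc (ν + θ) (ν + 1 - θ)),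
      unitExp (f n)‖ ≤ 2 / θ := by
    have hmem : ∀ n, a ≤ n → n < b → n < L ∧ d n ∈ Set.Icc (ν + θ) (ν + 1 - θ) := fun n h1 h2 ↦ by
      have : n ∈ Finset.Ico a b := Finset.mem_Ico.2 ⟨h1, h2⟩
      rwa [← hab, Finset.mem_filter, Finset.mem_range] at this
    rw [hab, Finset.sum_Ico_eq_sum_range]
    have e1 : ∀ i, unitExp (f (a + i)) = unitExp (f (a + i) - ν * i) := fun i ↦ by
      have h1 : f (a + i) = f (a + i) - ν * i + ((ν * i : ℤ) : ℝ) := by push_cast; ring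
      conv_lhs => rw [h1, unitExp_add, unitExp_int, mul_one]
    simp_rw [e1]
    refine kusmin_landau hθ (fun n hn ↦ ?_) (fun n hn ↦ ?_)
    · obtain ⟨h1, h2, h3⟩ := hmem (a + n) (by lia) (by lia)
      simp only [hd] at h2 h3
      rw [← add_assoc]
      push_cast
      constructor <;> linarith
    · obtain ⟨h1, -⟩ := hmem (a + n) (by lia) (by lia)
      have := h _ h1
      rw [← add_assoc, show a + (n + 2) = a + n + 1 + 1 by ring]
      push_cast
      linarith
  have hsplit : (Finset.range L).filter (fun n ↦ ⌊d n⌋ = ν) ⊆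
      (Finset.range L).filter (fun n ↦ d n ∈ Set.Ico (ν : ℝ) (ν + 1)) := fun n hn ↦ by
    rw [Finset.mem_filter] at hn ⊢
    exact ⟨hn.1, Int.floor_eq_iff.1 hn.2⟩
  rw [← Finset.sum_filter_add_sum_filter_not _ (fun n ↦ d n ∈ Set.Icc (ν + θ) (ν + 1 - θ))]
  have hsub : ((Finset.range L).filter (fun n ↦ ⌊d n⌋ = ν)).filter
      (fun n ↦ ¬ d n ∈ Set.Icc (ν + θ) (ν + 1 - θ)) ⊆
      (Finset.range L).filter (fun n ↦ d n ∈ Set.Ico (ν : ℝ) (ν + 1) ∩ Set.Iio (ν + θ)) ∪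
      (Finset.range L).filter (fun n ↦ d n ∈ Set.Ico (ν : ℝ) (ν + 1) ∩ Set.Ioi (ν + 1 - θ)) :=
    fun n hn ↦ by
      rw [Finset.mem_filter] at hn
      have h1 := Finset.mem_filter.1 (hsplit hn.1)
      rw [Finset.mem_union, Finset.mem_filter, Finset.mem_filter]
      by_cases h2 : d n < ν + θ
      · exact Or.inl ⟨h1.1, h1.2, h2⟩
      · refine Or.inr ⟨h1.1, h1.2, ?_⟩
        by_contra h3
        exact hn.2 ⟨not_lt.1 h2, not_lt.1 h3⟩
  have hcard : ((((Finset.range L).filter (fun n ↦ ⌊d n⌋ = ν)).filter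
      (fun n ↦ ¬ d n ∈ Set.Icc (ν + θ) (ν + 1 - θ))).card : ℝ) ≤ 2 * (θ / lam + 1) := by
    have := (Finset.card_le_card hsub).trans (Finset.card_union_le _ _)
    have : ((((Finset.range L).filter (fun n ↦ ⌊d n⌋ = ν)).filter
      (fun n ↦ ¬ d n ∈ Set.Icc (ν + θ) (ν + 1 - θ))).card : ℝ) ≤ _ := Nat.cast_le.2 this
    push_cast at this
    linarith
  have hmid' : ‖∑ n ∈ ((Finset.range L).filter (fun n ↦ ⌊d n⌋ = ν)).filter
      (fun n ↦ d n ∈ Set.Icc (ν + θ) (ν + 1 - θ)), unitExp (f n)‖ ≤ 2 / θ := by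
    convert hmid using 3
    ext n
    simp only [Finset.mem_filter, and_assoc, and_congr_right_iff, and_iff_right_iff_imp]
    intro _ hn
    rw [Int.floor_eq_iff]
    constructor <;> linarith [hn.1, hn.2]
  refine (norm_add_le _ _).trans ?_
  have := norm_sum_unitExp_le (((Finset.range L).filter (fun n ↦ ⌊d n⌋ = ν)).filter
      (fun n ↦ ¬ d n ∈ Set.Icc (ν + θ) (ν + 1 - θ))) f
  linarith

theorem second_difference_test {f : ℕ → ℝ} {L : ℕ} {lam c N δ : ℝ} (hlam : 0 < lam) (hc : 0 ≤ c)
    (hδ : 0 < δ) (hL : L ≤ N) (h1 : lam ≤ δ ^ 2) (h2 : 1 ≤ N ^ 2 * lam * δ ^ 2)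
    (h : ∀ n < L, lam ≤ (f (n + 1 + 1) - f (n + 1)) - (f (n + 1) - f n) ∧
      (f (n + 1 + 1) - f (n + 1)) - (f (n + 1) - f n) ≤ c * lam) :
    ‖∑ n ∈ Finset.range L, unitExp (f n)‖ ≤ (5 * c + 10) * δ * N := by
  have hN : 0 ≤ N := (Nat.cast_nonneg L).trans hL
  set θ := √lam with hθ_def
  have hθ : 0 < θ := Real.sqrt_pos.2 hlam
  have hθ2 : θ ^ 2 = lam := Real.sq_sqrt hlam.le
  have hθδ : θ ≤ δ := by
    rw [← hθ2] at h1
    exact (pow_le_pow_iff_left₀ hθ.le hδ.le two_ne_zero).1 h1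
  rcases le_or_gt θ (1 / 2) with hsmall | hbig
  swap
  · have := norm_sum_unitExp_le (Finset.range L) f
    rw [Finset.card_range] at this
    have : 0 ≤ c * δ * N := by positivity
    nlinarith
  set d : ℕ → ℝ := fun n ↦ f (n + 1) - f n with hd
  have hlow : ∀ n < L, lam ≤ d (n + 1) - d n := fun n hn ↦ (h n hn).1
  have hup : ∀ n < L, -(c * lam) ≤ -d (n + 1) - -d n := fun n hn ↦ by
    have := (h n hn).2
    simp only [hd]
    linarith
  have hmono : ∀ p q, p ≤ q → q ≤ L → d p ≤ d q := fun p q hpq hq ↦ by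
    have := mul_sub_le_sub_of_le_step (d := d) hlow hpq hq
    have h2 : (p : ℝ) ≤ q := by exact_mod_cast hpq
    nlinarith
  have hrange : d L - d 0 ≤ c * lam * N := by
    have := mul_sub_le_sub_of_le_step (d := fun n ↦ -d n) hup (Nat.zero_le L) le_rfl
    have h3 : c * lam * L ≤ c * lam * N := by gcongr
    push_cast at this
    linarith
  have hfib : ∑ n ∈ Finset.range L, unitExp (f n) = ∑ ν ∈ Finset.Icc ⌊d 0⌋ ⌊d L⌋,
      ∑ n ∈ (Finset.range L).filter (fun n ↦ ⌊d n⌋ = ν), unitExp (f n) := by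
    rw [Finset.sum_fiberwise_of_maps_to]
    intro n hn
    rw [Finset.mem_range] at hn
    exact Finset.mem_Icc.2 ⟨Int.floor_mono (hmono 0 n (Nat.zero_le n) hn.le),
      Int.floor_mono (hmono n L hn.le le_rfl)⟩
  have hcard : ((Finset.Icc ⌊d 0⌋ ⌊d L⌋).card : ℝ) ≤ c * lam * N + 2 := by
    rw [Int.card_Icc]
    have h3 : ⌊d 0⌋ ≤ ⌊d L⌋ := Int.floor_mono (hmono 0 L (Nat.zero_le L) le_rfl)
    have h4 : (((⌊d L⌋ + 1 - ⌊d 0⌋).toNat : ℤ) : ℝ) = ⌊d L⌋ + 1 - ⌊d 0⌋ := by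
      rw [Int.toNat_of_nonneg (by lia)]
      push_cast
      ring
    rw [Int.cast_natCast] at h4
    rw [h4]
    linarith [Int.floor_le (d L), Int.lt_floor_add_one (d 0)]
  have hbound : 2 * (θ / lam + 1) + 2 / θ ≤ 5 / θ := by
    rw [← hθ2]
    have e1 : θ / θ ^ 2 = 1 / θ := by field_simp
    have e2 : 2 ≤ 1 / θ := by rw [le_div_iff₀ hθ]; linarith
    have e3 : 2 / θ = 2 * (1 / θ) := by ring
    have e4 : 5 / θ = 5 * (1 / θ) := by ring
    rw [e1, e3, e4]
    linarith
  have hN1 : 1 / θ ≤ N * δ := by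
    rw [div_le_iff₀ hθ]
    have : (1 : ℝ) ^ 2 ≤ (N * δ * θ) ^ 2 := by
      rw [mul_pow, mul_pow, hθ2]; linarith
    exact (pow_le_pow_iff_left₀ zero_le_one (by positivity) two_ne_zero).1 this
  calc ‖∑ n ∈ Finset.range L, unitExp (f n)‖
      ≤ (Finset.Icc ⌊d 0⌋ ⌊d L⌋).card • (5 / θ) := by
        rw [hfib]
        refine (norm_sum_le _ _).trans (Finset.sum_le_card_nsmul _ _ _ fun ν _ ↦ ?_)
        exact (norm_sum_floor_fiber_le hlam hθ (fun n hn ↦ (h n hn).1) ν).trans hbound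
    _ ≤ (c * lam * N + 2) * (5 / θ) := by rw [nsmul_eq_mul]; gcongr
    _ = 5 * c * N * θ + 10 * (1 / θ) := by rw [← hθ2]; field_simp; ring
    _ ≤ 5 * c * N * δ + 10 * (N * δ) := by gcongr
    _ = (5 * c + 10) * δ * N := by ring

theorem sum_shift_mul_conj_shift (z : ℕ → ℂ) {L Q q q' : ℕ} (hqq : q ≤ q') (hq : q ≤ Q)
    {Z : ℕ → ℂ} (hZ : ∀ n, Z n = if Q ≤ n ∧ n < Q + L then z (n - Q) else 0) :
    ∑ m ∈ Finset.range (L + Q), Z (m + q') * (starRingEnd ℂ) (Z (m + q)) =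
      ∑ n ∈ Finset.range (L - (q' - q)), z (n + (q' - q)) * (starRingEnd ℂ) (z n) := by
  symm
  refine Finset.sum_of_injOn (fun n ↦ n + Q - q) ?_ ?_ ?_ ?_
  · intro a _ b _ hab
    simp only at hab
    lia
  · intro a ha
    simp only [Finset.coe_range, Set.mem_Iio] at ha ⊢
    lia
  · intro m hm hm'
    rw [hZ, hZ]
    by_cases h : (Q ≤ m + q' ∧ m + q' < Q + L) ∧ (Q ≤ m + q ∧ m + q < Q + L)
    · exfalso
      apply hm'
      refine ⟨m + q - Q, ?_, ?_⟩
      · simp only [Finset.coe_range, Set.mem_Iio]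
        lia
      · lia
    · rw [not_and_or] at h
      rcases h with h | h <;> simp [h]
  · intro n hn
    rw [Finset.mem_range] at hn
    rw [hZ, hZ, if_pos (by lia), if_pos (by lia)]
    congr 2
    · lia
    · congr 1
      lia

theorem sum_absDiff_le {Q q : ℕ} (hq : q < Q) {T : ℕ → ℝ} (hT : ∀ r, 0 ≤ T r) :
    ∑ q' ∈ Finset.range Q, T ((q - q') + (q' - q)) ≤ 2 * ∑ r ∈ Finset.range Q, T r := by
  rw [← Finset.sum_fiberwise_of_maps_to (t := Finset.range Q) (g := fun q' ↦ (q - q') + (q' - q))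
    (fun q' hq' ↦ by rw [Finset.mem_range] at hq' ⊢; lia), Finset.mul_sum]
  refine Finset.sum_le_sum fun r _ ↦ ?_
  rw [Finset.sum_congr rfl (g := fun _ ↦ T r) (fun q' hq' ↦ by rw [(Finset.mem_filter.1 hq').2]),
    Finset.sum_const, nsmul_eq_mul]
  refine mul_le_mul_of_nonneg_right ?_ (hT r)
  have : (Finset.range Q).filter (fun q' ↦ (q - q') + (q' - q) = r) ⊆ {q - r, q + r} := by
    intro q' hq'
    have := (Finset.mem_filter.1 hq').2
    rw [Finset.mem_insert, Finset.mem_singleton]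
    lia
  exact_mod_cast (Finset.card_le_card this).trans Finset.card_le_two

theorem van_der_corput_inequality (z : ℕ → ℂ) (L Q : ℕ) :
    (Q * ‖∑ n ∈ Finset.range L, z n‖) ^ 2 ≤ (L + Q) * (Q * (2 * ∑ r ∈ Finset.range Q,
      ‖∑ n ∈ Finset.range (L - r), z (n + r) * (starRingEnd ℂ) (z n)‖)) := by
  set Z : ℕ → ℂ := fun n ↦ if Q ≤ n ∧ n < Q + L then z (n - Q) else 0 with hZ
  set T : ℕ → ℝ := fun r ↦ ‖∑ n ∈ Finset.range (L - r), z (n + r) * (starRingEnd ℂ) (z n)‖ with hT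
  set u : ℕ → ℂ := fun m ↦ ∑ q ∈ Finset.range Q, Z (m + q) with hu
  have hshift : ∀ q ∈ Finset.range Q, ∑ m ∈ Finset.range (L + Q), Z (m + q) =
      ∑ n ∈ Finset.range L, z n := fun q hq ↦ by
    rw [Finset.mem_range] at hq
    symm
    refine Finset.sum_of_injOn (fun n ↦ n + Q - q) ?_ ?_ ?_ ?_
    · intro a _ b _ hab
      simp only at hab
      lia
    · intro a ha
      simp only [Finset.coe_range, Set.mem_Iio] at ha ⊢
      lia
    · intro m hm hm'
      simp only [hZ]
      rw [if_neg]
      intro h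
      apply hm'
      refine ⟨m + q - Q, ?_, ?_⟩
      · simp only [Finset.coe_range, Set.mem_Iio]
        lia
      · simp only
        lia
    · intro n hn
      rw [Finset.mem_range] at hn
      simp only [hZ]
      rw [if_pos (by lia)]
      congr 1
      lia
  have hsum : ∑ m ∈ Finset.range (L + Q), u m = Q * ∑ n ∈ Finset.range L, z n := by
    simp only [hu]
    rw [Finset.sum_comm, Finset.sum_congr rfl hshift, Finset.sum_const, Finset.card_range,
      nsmul_eq_mul]
  have hcross : ∀ q ∈ Finset.range Q, ∀ q' ∈ Finset.range Q,
      ‖∑ m ∈ Finset.range (L + Q), Z (m + q) * (starRingEnd ℂ) (Z (m + q'))‖ =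
        T ((q - q') + (q' - q)) := by
    intro q hq q' hq'
    rw [Finset.mem_range] at hq hq'
    rcases le_total q q' with h | h
    · rw [← RCLike.norm_conj, map_sum]
      simp only [map_mul, Complex.conj_conj]
      simp_rw [mul_comm ((starRingEnd ℂ) (Z _))]
      rw [sum_shift_mul_conj_shift z h hq.le (fun n ↦ rfl), Nat.sub_eq_zero_of_le h, zero_add]
    · rw [sum_shift_mul_conj_shift z h hq'.le (fun n ↦ rfl), Nat.sub_eq_zero_of_le h, add_zero]
  have hsq : ∑ m ∈ Finset.range (L + Q), ‖u m‖ ^ 2 ≤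
      Q * (2 * ∑ r ∈ Finset.range Q, T r) := by
    have h1 : ((∑ m ∈ Finset.range (L + Q), ‖u m‖ ^ 2 : ℝ) : ℂ) =
        ∑ q ∈ Finset.range Q, ∑ q' ∈ Finset.range Q,
          ∑ m ∈ Finset.range (L + Q), Z (m + q) * (starRingEnd ℂ) (Z (m + q')) := by
      push_cast
      have : ∀ m, (‖u m‖ : ℂ) ^ 2 = ∑ q ∈ Finset.range Q, ∑ q' ∈ Finset.range Q,
          Z (m + q) * (starRingEnd ℂ) (Z (m + q')) := fun m ↦ by
        rw [← Complex.mul_conj', hu, map_sum, Finset.sum_mul_sum]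
      simp_rw [this]
      rw [Finset.sum_comm]
      exact Finset.sum_congr rfl fun q _ ↦ Finset.sum_comm
    have h2 : ∑ m ∈ Finset.range (L + Q), ‖u m‖ ^ 2 =
        ‖((∑ m ∈ Finset.range (L + Q), ‖u m‖ ^ 2 : ℝ) : ℂ)‖ := by
      rw [Complex.norm_real, Real.norm_of_nonneg (by positivity)]
    rw [h2, h1]
    calc _ ≤ ∑ q ∈ Finset.range Q, ∑ q' ∈ Finset.range Q, T ((q - q') + (q' - q)) := by
          refine (norm_sum_le _ _).trans (Finset.sum_le_sum fun q hq ↦ ?_)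
          refine (norm_sum_le _ _).trans (Finset.sum_le_sum fun q' hq' ↦ ?_)
          exact (hcross q hq q' hq').le
      _ ≤ ∑ q ∈ Finset.range Q, 2 * ∑ r ∈ Finset.range Q, T r :=
          Finset.sum_le_sum fun q hq ↦ sum_absDiff_le (Finset.mem_range.1 hq)
            fun r ↦ norm_nonneg _
      _ = _ := by rw [Finset.sum_const, Finset.card_range, nsmul_eq_mul]
  have hcs := sq_sum_le_card_mul_sum_sq (s := Finset.range (L + Q)) (f := fun m ↦ ‖u m‖)
  rw [Finset.card_range] at hcs
  have hnorm : Q * ‖∑ n ∈ Finset.range L, z n‖ ≤ ∑ m ∈ Finset.range (L + Q), ‖u m‖ := by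
    have := norm_sum_le (Finset.range (L + Q)) u
    rwa [hsum, norm_mul, Complex.norm_natCast] at this
  calc (Q * ‖∑ n ∈ Finset.range L, z n‖) ^ 2 ≤ (∑ m ∈ Finset.range (L + Q), ‖u m‖) ^ 2 := by
        gcongr
    _ ≤ ((L + Q : ℕ) : ℝ) * ∑ m ∈ Finset.range (L + Q), ‖u m‖ ^ 2 := hcs
    _ ≤ ((L + Q : ℕ) : ℝ) * (Q * (2 * ∑ r ∈ Finset.range Q, T r)) := by gcongr
    _ = _ := by push_cast; rfl

theorem fwdDiff_iter_shift_sub (f : ℕ → ℝ) (k r n : ℕ) :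
    (fwdDiff 1)^[k] (fun m ↦ f (m + r) - f m) n =
      ∑ i ∈ Finset.range r, (fwdDiff 1)^[k + 1] f (n + i) := by
  have h1 : (fun m ↦ f (m + r) - f m) = ∑ i ∈ Finset.range r, fun m ↦ fwdDiff 1 f (m + i) := by
    ext m
    rw [Finset.sum_apply]
    simp only [fwdDiff]
    exact (Finset.sum_range_sub (fun i ↦ f (m + i)) r).symm
  rw [h1, fwdDiff_iter_finsetSum, Finset.sum_apply]
  refine Finset.sum_congr rfl fun i _ ↦ ?_
  rw [fwdDiff_iter_comp_add, Function.iterate_succ_apply]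

theorem sum_Ico_inv_sqrt_le (n : ℕ) : ∑ r ∈ Finset.Ico 1 (n + 1), 1 / √(r : ℝ) ≤ 2 * √(n : ℝ) := by
  induction n with
  | zero => simp
  | succ n ih =>
    rw [Finset.sum_Ico_succ_top (by lia)]
    have h0 : (0 : ℝ) ≤ n := Nat.cast_nonneg n
    push_cast
    have h1 : 0 < √(n + 1 : ℝ) := Real.sqrt_pos.2 (by linarith)
    have h2 := Real.sq_sqrt h0
    have h3 := Real.sq_sqrt (by linarith : (0 : ℝ) ≤ n + 1)
    have h4 : 1 / √(n + 1 : ℝ) ≤ 2 * √(n + 1 : ℝ) - 2 * √(n : ℝ) := by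
      rw [div_le_iff₀ h1]
      nlinarith [sq_nonneg (√(n + 1 : ℝ) - √(n : ℝ))]
    linarith

theorem difference_test (j : ℕ) {c : ℝ} (hc : 0 ≤ c) : ∃ C : ℝ, 1 ≤ C ∧
    ∀ (f : ℕ → ℝ) (L : ℕ) (N lam δ : ℝ), 0 < lam → 0 < δ → L ≤ N →
      lam ≤ δ ^ (2 ^ (j + 2) - 2) → 1 ≤ N * δ ^ 2 ^ (j + 1) →
      1 ≤ N ^ (j + 2) * lam * δ ^ 2 ^ (j + 1) →
      (∀ n < L, lam ≤ (fwdDiff 1)^[j + 2] f n ∧ (fwdDiff 1)^[j + 2] f n ≤ c * lam) →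
      ‖∑ n ∈ Finset.range L, unitExp (f n)‖ ≤ C * δ * N := by
  induction j with
  | zero =>
    refine ⟨5 * c + 10, by linarith, fun f L N lam δ hlam hδ hL h1 _ h2 h ↦ ?_⟩
    refine second_difference_test hlam hc hδ hL (by simpa using h1) (by simpa using h2) h
  | succ j ih =>
    obtain ⟨C, hC, ih⟩ := ih
    refine ⟨8 + 16 * C, by linarith, fun f L N lam δ hlam hδ hL h1 h2 h3 h ↦ ?_⟩
    have hN : 0 ≤ N := (Nat.cast_nonneg L).trans hL
    rcases le_or_gt δ 1 with hδ1 | hδ1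
    swap
    · have := norm_sum_unitExp_le (Finset.range L) f
      rw [Finset.card_range] at this
      have : 1 * 1 * N ≤ (8 + 16 * C) * δ * N := by gcongr; linarith
      linarith
    obtain ⟨K, hK⟩ : ∃ K, K = 2 ^ (j + 1) := ⟨_, rfl⟩
    have hK2 : 2 ≤ K := by
      rw [hK, pow_succ]; have := Nat.one_le_two_pow (n := j); lia
    have hjK : 3 * K - 2 ≤ K * (j + 2) := by
      rcases Nat.eq_zero_or_pos j with rfl | hj
      · simp at hK; subst hK; norm_num
      · have : K * 3 ≤ K * (j + 2) := Nat.mul_le_mul_left K (by lia)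
        lia
    obtain ⟨ε, hε⟩ : ∃ ε, ε = δ ^ 2 := ⟨_, rfl⟩
    have hε0 : 0 < ε := hε ▸ by positivity
    have hε1 : ε ≤ 1 := hε ▸ pow_le_one₀ hδ.le hδ1
    have e1 : δ ^ (2 ^ (j + 1 + 2) - 2) = ε ^ (2 * K - 1) := by
      rw [hε, ← pow_mul]; congr 1; rw [hK]; ring_nf; lia
    have e2 : δ ^ 2 ^ (j + 1 + 1) = ε ^ K := by
      rw [hε, ← pow_mul]; congr 1; rw [hK]; ring
    rw [e1] at h1
    rw [e2] at h2 h3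
    have e3 : 2 ^ (j + 2) - 2 = 2 * K - 2 := by rw [hK, pow_succ' 2 (j + 1)]
    rw [e3, ← hK] at ih
    set R := min N (ε ^ (2 * K - 2) / lam) with hR
    have hRN : R ≤ N := min_le_left _ _
    have hRlam : R * lam ≤ ε ^ (2 * K - 2) := by
      rw [← le_div_iff₀ hlam]; exact min_le_right _ _
    have hRε : 1 ≤ R * ε := by
      rw [← div_le_iff₀ hε0]
      refine le_min ?_ ?_
      · rw [div_le_iff₀ hε0]
        refine h2.trans ?_
        gcongr
        exact pow_le_of_le_one hε0.le hε1 (by lia)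
      · rw [div_le_div_iff₀ hε0 hlam, one_mul, ← pow_succ]
        rwa [show 2 * K - 2 + 1 = 2 * K - 1 by lia]
    have hR1 : 1 ≤ R := by nlinarith
    have hbig : 1 ≤ N ^ (j + 2) * lam * R * ε ^ K := by
      rcases min_choice N (ε ^ (2 * K - 2) / lam) with hm | hm
      · rw [hR, hm]
        convert h3 using 1
        ring
      · have : N ^ (j + 2) * lam * R * ε ^ K = N ^ (j + 2) * ε ^ (3 * K - 2) := by
          rw [hR, hm, show 3 * K - 2 = (2 * K - 2) + K by lia, pow_add]
          field_simp
          ring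
        rw [this]
        calc (1 : ℝ) ≤ (N * ε ^ K) ^ (j + 2) := one_le_pow₀ h2
          _ = N ^ (j + 2) * ε ^ (K * (j + 2)) := by rw [mul_pow, ← pow_mul]
          _ ≤ _ := by
            gcongr ?_ * ?_
            exact pow_le_pow_of_le_one hε0.le hε1 hjK
    set Q := ⌊R⌋₊ with hQ
    have hQ1 : 1 ≤ Q := Nat.one_le_floor_iff R |>.2 hR1
    have hQR : (Q : ℝ) ≤ R := Nat.floor_le (by linarith)
    have hQ1' : (1 : ℝ) ≤ Q := by exact_mod_cast hQ1
    have hRQ : R ≤ 2 * Q := by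
      have := Nat.lt_floor_add_one R
      linarith
    have hT : ∀ r ∈ Finset.Ico 1 Q,
        ‖∑ n ∈ Finset.range (L - r), unitExp (f (n + r)) * (starRingEnd ℂ) (unitExp (f n))‖ ≤
          C * ε * N * √R * (1 / √(r : ℝ)) := by
      intro r hr
      rw [Finset.mem_Ico] at hr
      have hr0 : (0 : ℝ) < r := by exact_mod_cast hr.1
      have hrR : (r : ℝ) ≤ R := le_trans (by exact_mod_cast hr.2.le) hQR
      set s := √(R / r) with hs
      have hs2 : s ^ 2 = R / r := Real.sq_sqrt (by positivity)
      have hs1 : 1 ≤ s := by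
        rw [hs, Real.one_le_sqrt, one_le_div hr0]; exact hrR
      have := ih (fun m ↦ f (m + r) - f m) (L - r) N (r * lam) (ε * s) (by positivity)
        (by positivity) (le_trans (by exact_mod_cast Nat.sub_le L r) hL) ?_ ?_ ?_ ?_
      · simp_rw [conj_unitExp, ← unitExp_add, ← sub_eq_add_neg]
        refine this.trans (le_of_eq ?_)
        rw [hs, Real.sqrt_div (by linarith)]
        ring
      · calc r * lam ≤ R * lam := by gcongr
          _ ≤ ε ^ (2 * K - 2) := hRlam
          _ ≤ (ε * s) ^ (2 * K - 2) := by
            gcongr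
            exact le_mul_of_one_le_right hε0.le hs1
      · refine h2.trans ?_
        gcongr
        exact le_mul_of_one_le_right hε0.le hs1
      · refine hbig.trans ?_
        calc N ^ (j + 2) * lam * R * ε ^ K = N ^ (j + 2) * (r * lam) * (ε ^ K * s ^ 2) := by
              rw [hs2]; field_simp
          _ ≤ N ^ (j + 2) * (r * lam) * (ε * s) ^ K := by
              rw [mul_pow]
              gcongr
      · intro n hn
        rw [fwdDiff_iter_shift_sub]
        have hb : ∀ i ∈ Finset.range r, lam ≤ (fwdDiff 1)^[j + 2 + 1] f (n + i) ∧
            (fwdDiff 1)^[j + 2 + 1] f (n + i) ≤ c * lam := fun i hi ↦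
          h (n + i) (by rw [Finset.mem_range] at hi; lia)
        have hl := Finset.card_nsmul_le_sum _ _ _ fun i hi ↦ (hb i hi).1
        have hu := Finset.sum_le_card_nsmul _ _ _ fun i hi ↦ (hb i hi).2
        rw [Finset.card_range, nsmul_eq_mul] at hl hu
        exact ⟨hl, hu.trans (le_of_eq (by ring))⟩
    have hvdc := van_der_corput_inequality (fun n ↦ unitExp (f n)) L Q
    set S := ‖∑ n ∈ Finset.range L, unitExp (f n)‖ with hS
    have hsum : ∑ r ∈ Finset.range Q,
        ‖∑ n ∈ Finset.range (L - r), unitExp (f (n + r)) * (starRingEnd ℂ) (unitExp (f n))‖ ≤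
          N + 2 * C * ε * N * R := by
      rw [Finset.range_eq_Ico, Finset.sum_eq_sum_Ico_succ_bot (by lia)]
      refine add_le_add ?_ ?_
      · refine (norm_sum_le _ _).trans ?_
        simp only [norm_mul, RCLike.norm_conj, norm_unitExp]
        simpa using hL
      · refine (Finset.sum_le_sum hT).trans ?_
        rw [← Finset.mul_sum]
        calc C * ε * N * √R * ∑ r ∈ Finset.Ico 1 Q, 1 / √(r : ℝ)
            ≤ C * ε * N * √R * (2 * √R) := by
              gcongr
              obtain ⟨q, hq⟩ : ∃ q, Q = q + 1 := ⟨Q - 1, by lia⟩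
              rw [hq]
              refine (sum_Ico_inv_sqrt_le q).trans ?_
              gcongr
              refine le_trans ?_ hQR
              rw [hq]
              push_cast
              linarith
          _ = 2 * C * ε * N * (√R) ^ 2 := by ring
          _ = _ := by rw [Real.sq_sqrt (by linarith)]
    have hfin : S ^ 2 ≤ ((8 + 16 * C) * δ * N) ^ 2 := by
      have h5 : (Q * S) ^ 2 ≤ 2 * N * (Q * (2 * (N + 2 * C * ε * N * R))) := by
        refine hvdc.trans ?_
        gcongr
        linarith
      have h6 : Q * (Q * S ^ 2) ≤ Q * (4 * N ^ 2 * (1 + 2 * C * ε * R)) := by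
        linarith
      have h7 : Q * S ^ 2 ≤ 4 * N ^ 2 * (1 + 2 * C * ε * R) :=
        le_of_mul_le_mul_left h6 (by linarith)
      have h8 : 4 * N ^ 2 * (1 + 2 * C * ε * R) ≤ Q * ((8 + 16 * C) * ε * N ^ 2) := by
        calc 4 * N ^ 2 * (1 + 2 * C * ε * R) ≤ 4 * N ^ 2 * (R * ε + 2 * C * ε * R) := by gcongr
          _ = R * ((4 + 8 * C) * ε * N ^ 2) := by ring
          _ ≤ 2 * Q * ((4 + 8 * C) * ε * N ^ 2) := by gcongr
          _ = _ := by ring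
      have h9 : S ^ 2 ≤ (8 + 16 * C) * ε * N ^ 2 :=
        le_of_mul_le_mul_left (h7.trans h8) (by linarith)
      refine h9.trans ?_
      rw [mul_pow, mul_pow, ← hε]
      gcongr
      nlinarith
    exact (pow_le_pow_iff_left₀ (norm_nonneg _) (by positivity) two_ne_zero).1 hfin

theorem hasSum_cos_div_sq (x : ℝ) :
    HasSum (fun h : ℕ ↦ 1 / (h : ℝ) ^ 2 * cos (2 * π * h * x))
      (π ^ 2 * (Int.fract x ^ 2 - Int.fract x + 1 / 6)) := by
  have h := hasSum_one_div_nat_pow_mul_cos (k := 1) one_ne_zero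
    (x := Int.fract x) ⟨Int.fract_nonneg x, (Int.fract_lt_one x).le⟩
  have e : ((Polynomial.map (algebraMap ℚ ℝ) (Polynomial.bernoulli (2 * 1))).eval (Int.fract x)) =
      Int.fract x ^ 2 - Int.fract x + 1 / 6 := by
    have : Polynomial.bernoulli 2 = Polynomial.X ^ 2 - Polynomial.X + Polynomial.C (1 / 6) := by
      simp [Polynomial.bernoulli, Finset.sum_range_succ, bernoulli_two, bernoulli_one,
        ← Polynomial.C_mul_X_pow_eq_monomial]
      have h2 : (Polynomial.C (-1 / 2) * 2 : Polynomial ℚ) = -1 := by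
        rw [show (2 : Polynomial ℚ) = Polynomial.C 2 from rfl, ← Polynomial.C_mul]
        norm_num
      rw [h2]
      ring
    simp [this]
  rw [e] at h
  convert h using 1
  · ext n
    simp only [mul_one]
    congr 1
    rw [Int.fract, mul_sub, ← Real.cos_sub_int_mul_two_pi _ (n * ⌊x⌋)]
    congr 1
    push_cast
    ring
  · rw [Nat.factorial_two]
    push_cast
    ring

/-- The sawtooth primitive `{x}² - {x}`, whose derivative is `2({x} - 1/2)`. -/
noncomputable def fractPrimitive (x : ℝ) : ℝ := Int.fract x ^ 2 - Int.fract x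

theorem fractPrimitive_add_sub_le {δ : ℝ} (h0 : 0 ≤ δ) (h1 : δ ≤ 1) (x : ℝ) :
    fractPrimitive (x + δ) - fractPrimitive x ≤ 2 * δ * (Int.fract x - 1 / 2) + δ ^ 2 := by
  have ht := Int.fract_nonneg x
  have ht1 := Int.fract_lt_one x
  have hx : x = ⌊x⌋ + Int.fract x := (Int.floor_add_fract x).symm
  unfold fractPrimitive
  rcases lt_or_ge (Int.fract x + δ) 1 with h | h
  · have : Int.fract (x + δ) = Int.fract x + δ := by
      rw [Int.fract_eq_iff]
      exact ⟨by linarith, h, ⌊x⌋, by linarith⟩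
    rw [this]
    nlinarith
  · have : Int.fract (x + δ) = Int.fract x + δ - 1 := by
      rw [Int.fract_eq_iff]
      exact ⟨by linarith, by linarith, ⌊x⌋ + 1, by push_cast; linarith⟩
    rw [this]
    nlinarith

theorem le_fractPrimitive_sub {δ : ℝ} (h0 : 0 ≤ δ) (h1 : δ ≤ 1) (x : ℝ) :
    2 * δ * (Int.fract x - 1 / 2) - δ ^ 2 ≤ fractPrimitive x - fractPrimitive (x + -δ) := by
  have ht := Int.fract_nonneg x
  have ht1 := Int.fract_lt_one x
  have hx : x = ⌊x⌋ + Int.fract x := (Int.floor_add_fract x).symm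
  unfold fractPrimitive
  rcases le_or_gt δ (Int.fract x) with h | h
  · have : Int.fract (x + -δ) = Int.fract x - δ := by
      rw [Int.fract_eq_iff]
      exact ⟨by linarith, by linarith, ⌊x⌋, by linarith⟩
    rw [this]
    nlinarith
  · have : Int.fract (x + -δ) = Int.fract x - δ + 1 := by
      rw [Int.fract_eq_iff]
      exact ⟨by linarith, by linarith, ⌊x⌋ - 1, by push_cast; linarith⟩
    rw [this]
    nlinarith

theorem one_div_mul_sqrt_le {h : ℝ} (hh : 1 ≤ h) :
    1 / (h * √h) ≤ 4 * (1 / √h - 1 / √(h + 1)) := by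
  have ha : 0 < √h := Real.sqrt_pos.2 (by linarith)
  have hb : 0 < √(h + 1) := Real.sqrt_pos.2 (by linarith)
  have ha2 : √h ^ 2 = h := Real.sq_sqrt (by linarith)
  have hb2 : √(h + 1) ^ 2 = h + 1 := Real.sq_sqrt (by linarith)
  generalize √h = a at *
  generalize √(h + 1) = b at *
  have e : 4 * (1 / a - 1 / b) = 4 / (a * b * (a + b)) := by
    have : (b - a) * (a + b) = 1 := by linarith [hb2, ha2, sq_sub_sq b a]
    field_simp
    linarith
  rw [e, div_le_div_iff₀ (by positivity) (by positivity)]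
  have : b * (a + b) ≤ 4 * h := by nlinarith [sq_nonneg (a - b)]
  nlinarith [mul_le_mul_of_nonneg_left this ha.le]

theorem sum_weight_le {H : ℝ} (hH : 1 ≤ H) (n : ℕ) :
    ∑ h ∈ Finset.range n, min (H / (h : ℝ) ^ 2) (1 / h) * (1 + √(h / H)) ≤
      10 * (1 + log H) := by
  set w : ℕ → ℝ := fun h ↦ min (H / (h : ℝ) ^ 2) (1 / h) * (1 + √(h / H)) with hw
  have hw0 : ∀ h, 0 ≤ w h := fun h ↦ by
    have : 0 ≤ min (H / (h : ℝ) ^ 2) (1 / h) := by positivity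
    positivity
  obtain ⟨F, hF⟩ : ∃ F, F = ⌊H⌋₊ := ⟨_, rfl⟩
  have hFH : (F : ℝ) ≤ H := hF ▸ Nat.floor_le (by linarith)
  have hHF : H < F + 1 := hF ▸ Nat.lt_floor_add_one H
  have hsmall : ∀ h : ℕ, (h : ℝ) ≤ H → w h ≤ 2 * (h : ℝ)⁻¹ := fun h hh ↦ by
    have h1 : √(h / H) ≤ 1 := by
      rw [Real.sqrt_le_one, div_le_one (by linarith)]; exact hh
    have h2 : min (H / (h : ℝ) ^ 2) (1 / h) ≤ (h : ℝ)⁻¹ := (min_le_right _ _).trans (by simp)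
    have h3 : (0 : ℝ) ≤ (h : ℝ)⁻¹ := by positivity
    calc w h ≤ (h : ℝ)⁻¹ * (1 + 1) := by simp only [hw]; gcongr
      _ = _ := by ring
  have hlarge : ∀ h : ℕ, H ≤ h → w h ≤ 8 * √H * (1 / √(h : ℝ) - 1 / √((h + 1 : ℕ) : ℝ)) :=
    fun h hh ↦ by
      have hh0 : (0 : ℝ) < h := by linarith
      have h1 : 1 ≤ √(h / H) := by
        rw [Real.one_le_sqrt, one_le_div (by linarith)]; exact hh
      have h2 := one_div_mul_sqrt_le (hH.trans hh)
      have hsH : 0 < √H := Real.sqrt_pos.2 (by linarith)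
      have hsh : 0 < √(h : ℝ) := Real.sqrt_pos.2 hh0
      calc w h ≤ H / (h : ℝ) ^ 2 * (√(h / H) + √(h / H)) := by
            simp only [hw]; gcongr; exact min_le_left _ _
        _ = 2 * √H * (1 / (h * √(h : ℝ))) := by
            rw [Real.sqrt_div (by linarith)]
            have e1 := Real.sq_sqrt (by linarith : 0 ≤ H)
            have e2 := Real.sq_sqrt hh0.le
            field_simp
            rw [e1, e2]
            ring
        _ ≤ 2 * √H * (4 * (1 / √(h : ℝ) - 1 / √(h + 1))) := by gcongr
        _ = _ := by push_cast; ring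
  calc ∑ h ∈ Finset.range n, w h ≤ ∑ h ∈ Finset.range (F + 1 + n), w h :=
        Finset.sum_le_sum_of_subset_of_nonneg (Finset.range_subset_range.2 (by lia))
          fun h _ _ ↦ hw0 h
    _ = ∑ h ∈ Finset.range (F + 1), w h + ∑ i ∈ Finset.range n, w (F + 1 + i) :=
        Finset.sum_range_add _ _ _
    _ ≤ 2 * (1 + log H) + 8 := by
        refine add_le_add ?_ ?_
        · calc ∑ h ∈ Finset.range (F + 1), w h ≤ ∑ h ∈ Finset.range (F + 1), 2 * (h : ℝ)⁻¹ := by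
                refine Finset.sum_le_sum fun h hh ↦ hsmall h (le_trans ?_ hFH)
                rw [Finset.mem_range] at hh
                exact_mod_cast Nat.lt_succ_iff.1 hh
            _ = 2 * (harmonic F : ℝ) := by
                rw [← Finset.mul_sum, Finset.sum_range_succ', harmonic]
                simp
            _ ≤ 2 * (1 + log H) := by
                gcongr
                rw [hF]
                exact harmonic_floor_le_one_add_log H hH
        · calc ∑ i ∈ Finset.range n, w (F + 1 + i)
              ≤ ∑ i ∈ Finset.range n, 8 * √H * (1 / √((F + 1 + i : ℕ) : ℝ) -
                  1 / √((F + 1 + (i + 1) : ℕ) : ℝ)) := by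
                refine Finset.sum_le_sum fun i _ ↦ hlarge _ ?_
                push_cast
                have : (0 : ℝ) ≤ i := Nat.cast_nonneg i
                linarith
            _ = 8 * √H * (1 / √((F + 1 + 0 : ℕ) : ℝ) - 1 / √((F + 1 + n : ℕ) : ℝ)) := by
                rw [← Finset.mul_sum,
                  Finset.sum_range_sub' (fun i ↦ 1 / √((F + 1 + i : ℕ) : ℝ))]
            _ ≤ 8 * √H * (1 / √H) := by
                gcongr
                have h1 : 0 ≤ 1 / √((F + 1 + n : ℕ) : ℝ) := by positivity
                have h2 : 1 / √((F + 1 + 0 : ℕ) : ℝ) ≤ 1 / √H := by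
                  gcongr
                  push_cast
                  linarith
                linarith
            _ = 8 := by
                have : 0 < √H := Real.sqrt_pos.2 (by linarith)
                field_simp
    _ ≤ 10 * (1 + log H) := by linarith [Real.log_nonneg hH]

theorem norm_unitExp_sub_one_le (x : ℝ) : ‖unitExp x - 1‖ ≤ 2 * π * |x| := by
  have := Real.norm_exp_I_mul_ofReal_sub_one_le (x := 2 * π * x)
  rw [unitExp, mul_comm]
  refine this.trans (le_of_eq ?_)
  rw [Real.norm_eq_abs, abs_mul, abs_of_pos (by positivity)]

theorem re_unitExp (x : ℝ) : (unitExp x).re = cos (2 * π * x) := Complex.exp_ofReal_mul_I_re _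

theorem abs_sum_fractPrimitive_sub_le {x : ℕ → ℝ} {L : ℕ} {H E η : ℝ} (hH : 1 ≤ H)
    (hE : 0 ≤ E) (hη : |η| = 1 / H)
    (hS : ∀ h : ℕ, 1 ≤ h → ‖∑ n ∈ Finset.range L, unitExp (h * x n)‖ ≤ E * (1 + √(h / H))) :
    |∑ n ∈ Finset.range L, (fractPrimitive (x n + η) - fractPrimitive (x n))| ≤
      2 / H * (E * (10 * (1 + log H))) := by
  have hH0 : 0 < H := by linarith
  set t : ℕ → ℝ := fun h ↦ ∑ n ∈ Finset.range L,
    (1 / (h : ℝ) ^ 2 * cos (2 * π * h * (x n + η)) - 1 / (h : ℝ) ^ 2 * cos (2 * π * h * x n)) with ht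
  have hsum : HasSum t
      (π ^ 2 * ∑ n ∈ Finset.range L, (fractPrimitive (x n + η) - fractPrimitive (x n))) := by
    have e : π ^ 2 * ∑ n ∈ Finset.range L, (fractPrimitive (x n + η) - fractPrimitive (x n)) =
        ∑ n ∈ Finset.range L, (π ^ 2 * (Int.fract (x n + η) ^ 2 - Int.fract (x n + η) + 1 / 6) -
          π ^ 2 * (Int.fract (x n) ^ 2 - Int.fract (x n) + 1 / 6)) := by
      rw [Finset.mul_sum]
      refine Finset.sum_congr rfl fun n _ ↦ ?_
      simp only [fractPrimitive]
      ring
    rw [e]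
    exact hasSum_sum fun n _ ↦ (hasSum_cos_div_sq (x n + η)).sub (hasSum_cos_div_sq (x n))
  have hterm : ∀ h, |t h| ≤ π ^ 2 * (2 / H) * E * (min (H / (h : ℝ) ^ 2) (1 / h) * (1 + √(h / H))) := by
    intro h
    rcases Nat.eq_zero_or_pos h with rfl | hh
    · simp [ht]
    have hh0 : (0 : ℝ) < h := by exact_mod_cast hh
    have e : t h = 1 / (h : ℝ) ^ 2 *
        ((unitExp (h * η) - 1) * ∑ n ∈ Finset.range L, unitExp (h * x n)).re := by
      rw [Finset.mul_sum, Complex.re_sum, Finset.mul_sum]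
      refine Finset.sum_congr rfl fun n _ ↦ ?_
      rw [sub_mul, one_mul, ← unitExp_add, Complex.sub_re, re_unitExp, re_unitExp, mul_sub]
      congr 3 <;> ring_nf
    have h1 : ‖unitExp (h * η) - 1‖ ≤ 2 := by
      refine (norm_sub_le _ _).trans ?_
      rw [norm_unitExp, norm_one]; norm_num
    have h2 : ‖unitExp (h * η) - 1‖ ≤ 2 * π * (h / H) := by
      refine (norm_unitExp_sub_one_le _).trans (le_of_eq ?_)
      rw [abs_mul, hη, abs_of_pos hh0]
      ring
    have hpi : 1 ≤ π := by linarith [Real.pi_gt_three]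
    have h3 : 1 / (h : ℝ) ^ 2 * ‖unitExp (h * η) - 1‖ ≤
        π ^ 2 * (2 / H) * min (H / (h : ℝ) ^ 2) (1 / h) := by
      rw [mul_min_of_nonneg _ _ (by positivity)]
      refine le_min ?_ ?_
      · calc 1 / (h : ℝ) ^ 2 * ‖unitExp (h * η) - 1‖ ≤ 1 / (h : ℝ) ^ 2 * 2 := by gcongr
          _ ≤ π ^ 2 * (1 / (h : ℝ) ^ 2 * 2) :=
            le_mul_of_one_le_left (by positivity) (one_le_pow₀ hpi)
          _ = _ := by field_simp
      · calc 1 / (h : ℝ) ^ 2 * ‖unitExp (h * η) - 1‖ ≤ 1 / (h : ℝ) ^ 2 * (2 * π * (h / H)) := by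
              gcongr
          _ ≤ π * (1 / (h : ℝ) ^ 2 * (2 * π * (h / H))) :=
            le_mul_of_one_le_left (by positivity) hpi
          _ = _ := by field_simp
    rw [e, abs_mul, abs_of_pos (by positivity : 0 < 1 / (h : ℝ) ^ 2)]
    have h4 := Complex.abs_re_le_norm
      ((unitExp (h * η) - 1) * ∑ n ∈ Finset.range L, unitExp (h * x n))
    rw [norm_mul] at h4
    calc _ ≤ 1 / (h : ℝ) ^ 2 *
          (‖unitExp (h * η) - 1‖ * ‖∑ n ∈ Finset.range L, unitExp (h * x n)‖) := by gcongr
      _ = 1 / (h : ℝ) ^ 2 * ‖unitExp (h * η) - 1‖ *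
          ‖∑ n ∈ Finset.range L, unitExp (h * x n)‖ := by ring
      _ ≤ π ^ 2 * (2 / H) * min (H / (h : ℝ) ^ 2) (1 / h) * (E * (1 + √(h / H))) := by
          have := hS h hh
          have : 0 ≤ min (H / (h : ℝ) ^ 2) (1 / h) := by positivity
          gcongr
      _ = _ := by ring
  have hlim := hsum.tendsto_sum_nat.abs
  have hle := le_of_tendsto hlim (.of_forall fun n ↦ show _ ≤
      π ^ 2 * (2 / H * (E * (10 * (1 + log H)))) from
    calc |∑ h ∈ Finset.range n, t h| ≤ ∑ h ∈ Finset.range n, |t h| :=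
          Finset.abs_sum_le_sum_abs _ _
      _ ≤ _ := Finset.sum_le_sum fun h _ ↦ hterm h
      _ = π ^ 2 * (2 / H) * E * ∑ h ∈ Finset.range n,
          min (H / (h : ℝ) ^ 2) (1 / h) * (1 + √(h / H)) := by rw [Finset.mul_sum]
      _ ≤ π ^ 2 * (2 / H) * E * (10 * (1 + log H)) := by
          gcongr
          exact sum_weight_le hH n
      _ = _ := by ring)
  rw [abs_mul, abs_of_pos (by positivity : 0 < π ^ 2)] at hle
  exact le_of_mul_le_mul_left hle (by positivity)

theorem abs_sum_fract_sub_half_le {x : ℕ → ℝ} {L : ℕ} {H E : ℝ} (hH : 1 ≤ H) (hE : 0 ≤ E)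
    (hS : ∀ h : ℕ, 1 ≤ h → ‖∑ n ∈ Finset.range L, unitExp (h * x n)‖ ≤ E * (1 + √(h / H))) :
    |∑ n ∈ Finset.range L, (Int.fract (x n) - 1 / 2)| ≤ L / H + 10 * E * (1 + log H) := by
  have hH0 : 0 < H := by linarith
  have hδ : 1 / H ≤ 1 := by rw [div_le_one hH0]; exact hH
  have h1 := (abs_le.1 (abs_sum_fractPrimitive_sub_le (η := 1 / H) hH hE
    (abs_of_pos (by positivity)) hS)).1
  have h2 := (abs_le.1 (abs_sum_fractPrimitive_sub_le (η := -(1 / H)) hH hE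
    (by rw [abs_neg, abs_of_pos (by positivity)]) hS)).1
  have h3 := Finset.sum_le_sum fun n (_ : n ∈ Finset.range L) ↦
    fractPrimitive_add_sub_le (by positivity) hδ (x n)
  have h4 := Finset.sum_le_sum fun n (_ : n ∈ Finset.range L) ↦
    le_fractPrimitive_sub (by positivity) hδ (x n)
  rw [Finset.sum_add_distrib, ← Finset.mul_sum, Finset.sum_const, Finset.card_range,
    nsmul_eq_mul] at h3
  rw [Finset.sum_sub_distrib, ← Finset.mul_sum, Finset.sum_const, Finset.card_range,
    nsmul_eq_mul] at h4
  have h5 : ∑ n ∈ Finset.range L, (fractPrimitive (x n) - fractPrimitive (x n + -(1 / H))) =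
      -∑ n ∈ Finset.range L, (fractPrimitive (x n + -(1 / H)) - fractPrimitive (x n)) := by
    rw [← Finset.sum_neg_distrib]
    simp
  rw [h5] at h4
  generalize ∑ n ∈ Finset.range L, (Int.fract (x n) - 1 / 2) = P at *
  have e1 : L / H = H / 2 * (2 * (L * (1 / H) ^ 2)) := by field_simp
  have e2 : H / 2 * (2 * (1 / H) * P) = P := by field_simp
  have e3 : H / 2 * (2 / H * (E * (10 * (1 + log H)))) = 10 * E * (1 + log H) := by field_simp
  have hL : 0 ≤ (L : ℝ) * (1 / H) ^ 2 := by positivity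
  have hH2 : 0 ≤ H / 2 := by positivity
  rw [abs_le]
  constructor
  · have : H / 2 * (-(2 / H * (E * (10 * (1 + log H)))) - 2 * (L * (1 / H) ^ 2)) ≤
        H / 2 * (2 * (1 / H) * P) := by gcongr; linarith
    rw [mul_sub, mul_neg, e2, e3, ← e1] at this
    linarith
  · have : H / 2 * (2 * (1 / H) * P) ≤
        H / 2 * (2 / H * (E * (10 * (1 + log H))) + 2 * (L * (1 / H) ^ 2)) := by gcongr; linarith
    rw [mul_add, e2, e3, ← e1] at this
    linarith

theorem fwdDiff_iter_mem_Icc (k : ℕ) : ∀ (g : ℕ → ℝ → ℝ) (a A B : ℝ),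
    (∀ i < k, ∀ x ∈ Set.Icc a (a + k), HasDerivAt (g i) (g (i + 1) x) x) →
    (∀ x ∈ Set.Icc a (a + k), g k x ∈ Set.Icc A B) →
    (fwdDiff 1)^[k] (g 0) a ∈ Set.Icc A B := by
  induction k with
  | zero => intro g a A B _ h; exact h a (by simp)
  | succ k ih =>
    intro g a A B hd h
    rw [Function.iterate_succ_apply]
    refine ih (fun i ↦ fwdDiff 1 (g i)) a A B (fun i hi x hx ↦ ?_) fun x hx ↦ ?_
    · have h1 := hd i (by lia) x ⟨hx.1, hx.2.trans (by push_cast; linarith)⟩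
      have h2 := hd i (by lia) (x + 1) ⟨by linarith [hx.1], by push_cast; linarith [hx.2]⟩
      exact (h2.comp_add_const x 1).sub h1
    · have hI : ∀ y ∈ Set.Icc x (x + 1), y ∈ Set.Icc a (a + (k + 1 : ℕ)) := fun y hy ↦
        ⟨hx.1.trans hy.1, by push_cast; linarith [hx.2, hy.2]⟩
      obtain ⟨ξ, hξ, e⟩ := exists_hasDerivAt_eq_slope (g k) (g (k + 1)) (lt_add_one x)
        (fun y hy ↦ (hd k (lt_add_one k) y (hI y hy)).continuousAt.continuousWithinAt)
        (fun y hy ↦ hd k (lt_add_one k) y (hI y (Set.Ioo_subset_Icc_self hy)))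
      have : fwdDiff 1 (g k) x = g (k + 1) ξ := by rw [e, fwdDiff]; simp
      rw [this]
      exact h ξ (hI ξ (Set.Ioo_subset_Icc_self hξ))

theorem fwdDiff_iter_natCast (k : ℕ) (f : ℝ → ℝ) (a : ℝ) (n : ℕ) :
    (fwdDiff 1)^[k] (fun i : ℕ ↦ f (a + i)) n = (fwdDiff 1)^[k] f (a + n) := by
  rw [fwdDiff_iter_eq_sum_shift, fwdDiff_iter_eq_sum_shift]
  simp [add_assoc]

theorem fwdDiff_iter_const_mul_rpow_mem_Icc {α s a A B : ℝ} {k : ℕ} (ha : 0 < a)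
    (h : ∀ x ∈ Set.Icc a (a + k),
      s * (∏ l ∈ Finset.range k, (α - l)) * x ^ (α - k) ∈ Set.Icc A B) :
    (fwdDiff 1)^[k] (fun x : ℝ ↦ s * x ^ α) a ∈ Set.Icc A B := by
  have := fwdDiff_iter_mem_Icc k
    (fun i x ↦ s * (∏ l ∈ Finset.range i, (α - l)) * x ^ (α - i)) a A B
    (fun i _ x hx ↦ ?_) h
  · simpa using this
  · have h1 := (Real.hasDerivAt_rpow_const (x := x) (p := α - i)
      (Or.inl (by linarith [hx.1]))).const_mul (s * (∏ l ∈ Finset.range i, (α - l)))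
    refine h1.congr_deriv ?_
    rw [Finset.prod_range_succ, Nat.cast_succ, sub_add_eq_sub_sub]
    ring

theorem fwdDiff_iter_rpow_block_mem_Icc {α : ℝ} {k M n : ℕ} {h s : ℝ} (hα : α ≤ k) (hM : 1 ≤ M)
    (hn : n ≤ M) (hh : 0 ≤ h) (hs : s * (∏ l ∈ Finset.range k, (α - l)) =
      |∏ l ∈ Finset.range k, (α - l)|) :
    (fwdDiff 1)^[k] (fun i : ℕ ↦ s * (h * ((M : ℝ) + 1 + i) ^ α)) n ∈ Set.Icc
      (h * (|∏ l ∈ Finset.range k, (α - l)| * (k + 3) ^ (α - k) * (M : ℝ) ^ (α - k)))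
      ((k + 3) ^ (k - α) *
        (h * (|∏ l ∈ Finset.range k, (α - l)| * (k + 3) ^ (α - k) * (M : ℝ) ^ (α - k)))) := by
  have hM' : (1 : ℝ) ≤ M := by exact_mod_cast hM
  have hn' : (n : ℝ) ≤ M := by exact_mod_cast hn
  have e := fwdDiff_iter_natCast k (fun x : ℝ ↦ s * h * x ^ α) ((M : ℝ) + 1) n
  simp only [mul_assoc s h] at e
  rw [e]
  simp only [← mul_assoc s h]
  refine fwdDiff_iter_const_mul_rpow_mem_Icc (by positivity) fun x hx ↦ ?_
  rw [mul_right_comm s h, hs]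
  set P := |∏ l ∈ Finset.range k, (α - l)|
  have hP : 0 ≤ P := abs_nonneg _
  have hx1 : (M : ℝ) ≤ x := by linarith [hx.1, (Nat.cast_nonneg n : (0 : ℝ) ≤ n)]
  have hx2 : x ≤ (k + 3) * M := by
    nlinarith [hx.2, (Nat.cast_nonneg k : (0 : ℝ) ≤ k)]
  have hneg : α - k ≤ 0 := by linarith
  constructor
  · calc _ = P * h * ((k + 3) * M) ^ (α - k) := by
          rw [Real.mul_rpow (by positivity) (by positivity)]; ring
      _ ≤ _ := by
        gcongr P * h * ?_
        exact Real.rpow_le_rpow_of_nonpos (by linarith) hx2 hneg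
  · calc _ ≤ P * h * (M : ℝ) ^ (α - k) := by
          gcongr P * h * ?_
          exact Real.rpow_le_rpow_of_nonpos (by linarith) hx1 hneg
      _ = P * h * (M : ℝ) ^ (α - k) * (((k : ℝ) + 3) ^ (k - α) * (k + 3) ^ (α - k)) := by
          rw [← Real.rpow_add (by positivity)]; simp
      _ = _ := by ring

theorem exists_sign_mul_eq_abs (P : ℝ) : ∃ s : ℝ, (s = 1 ∨ s = -1) ∧ s * P = |P| := by
  rcases abs_choice P with h | h
  · exact ⟨1, .inl rfl, by rw [h, one_mul]⟩
  · exact ⟨-1, .inr rfl, by rw [h, neg_one_mul]⟩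

theorem norm_sum_unitExp_neg (f : ℕ → ℝ) (L : ℕ) :
    ‖∑ n ∈ Finset.range L, unitExp (-f n)‖ = ‖∑ n ∈ Finset.range L, unitExp (f n)‖ := by
  rw [← RCLike.norm_conj, map_sum]
  simp [conj_unitExp]

theorem norm_sum_unitExp_rpow_le {α σ : ℝ} {j : ℕ} (hαn : ∀ l : ℕ, α ≠ l) (hσ : 0 ≤ σ)
    (h1 : σ * 2 ^ (j + 1) ≤ 1) (h2 : σ * (2 ^ (j + 2) - 1) ≤ (j + 2 : ℕ) - α)
    (h3 : σ * 2 ^ (j + 1) ≤ α) :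
    ∃ C : ℝ, 0 ≤ C ∧ ∀ M L h : ℕ, 1 ≤ M → L ≤ M + 1 → 1 ≤ h →
      ‖∑ n ∈ Finset.range L, unitExp (h * ((M : ℝ) + 1 + n) ^ α)‖ ≤
        C * (M : ℝ) ^ (1 - σ) * (1 + √(h / (M : ℝ) ^ σ)) := by
  set k := j + 2 with hk
  set P := ∏ l ∈ Finset.range k, (α - l) with hP
  have hP0 : 0 < |P| := abs_pos.2 (Finset.prod_ne_zero_iff.2 fun l _ ↦ sub_ne_zero.2 (hαn l))
  set c : ℝ := |P| * ((k : ℝ) + 3) ^ (α - k) with hc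
  have hc0 : 0 < c := by positivity
  have hkα : α ≤ k := by
    have : 0 ≤ σ * ((2 : ℝ) ^ k - 1) :=
      mul_nonneg hσ (sub_nonneg.2 (one_le_pow₀ one_le_two))
    linarith
  obtain ⟨C, hC, H⟩ := difference_test j (c := ((k : ℝ) + 3) ^ (k - α)) (by positivity)
  set B : ℝ := 1 + c + 1 / c with hB
  have hcinv : 0 < 1 / c := by positivity
  have hB1 : 1 ≤ B := by linarith
  refine ⟨2 * C * B, by positivity, fun M L h hM hL hh ↦ ?_⟩
  have hM' : (1 : ℝ) ≤ M := by exact_mod_cast hM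
  have hM0 : (0 : ℝ) < M := by linarith
  have hh' : (1 : ℝ) ≤ h := by exact_mod_cast hh
  have hHpos : 0 < (M : ℝ) ^ σ := by positivity
  set q : ℝ := max 1 √(h / (M : ℝ) ^ σ) with hq
  have hq1 : 1 ≤ q := le_max_left _ _
  have hq2 : h * (M : ℝ) ^ (-σ) ≤ q ^ 2 := by
    rw [Real.rpow_neg hM0.le, ← div_eq_mul_inv]
    calc (h : ℝ) / (M : ℝ) ^ σ = √(h / (M : ℝ) ^ σ) ^ 2 := (Real.sq_sqrt (by positivity)).symm
      _ ≤ q ^ 2 := by gcongr; exact le_max_right _ _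
  have hq3 : q ≤ 1 + √(h / (M : ℝ) ^ σ) :=
    max_le (by linarith [Real.sqrt_nonneg (h / (M : ℝ) ^ σ)]) (by linarith)
  set lam : ℝ := h * (c * (M : ℝ) ^ (α - k)) with hlam
  set δ : ℝ := B * (M : ℝ) ^ (-σ) * q with hδ
  have hpow : ∀ n : ℕ, δ ^ n = B ^ n * (M : ℝ) ^ (-(σ * n)) * q ^ n := fun n ↦ by
    rw [hδ, mul_pow, mul_pow, ← Real.rpow_mul_natCast hM0.le, neg_mul]
  have hBpow : ∀ n : ℕ, n ≠ 0 → B ≤ B ^ n := fun n hn ↦ le_self_pow₀ hB1 hn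
  have hKpos : (2 : ℕ) ^ (j + 1) ≠ 0 := by positivity
  have hpk : 2 ^ k - 2 = 2 * (2 ^ (j + 1) - 1) := by rw [hk, pow_succ]; lia
  have hKone : 2 ≤ 2 ^ (j + 1) := by
    rw [pow_succ]; have := Nat.one_le_two_pow (n := j); lia
  have hcast : ((2 ^ k - 2 : ℕ) : ℝ) = 2 ^ k - 2 := by
    rw [Nat.cast_sub (by rw [hk, pow_succ]; lia)]; push_cast; rfl
  have cond1 : lam ≤ δ ^ (2 ^ k - 2) := by
    have e1 : q ^ 2 ≤ q ^ (2 ^ k - 2) := pow_le_pow_right₀ hq1 (by lia)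
    have e2 : B ≤ B ^ (2 ^ k - 2) := hBpow _ (by lia)
    rw [hpow, hcast]
    calc lam ≤ h * (B * (M : ℝ) ^ (-(σ * (2 ^ k - 2)) + -σ)) := by
          rw [hlam]
          gcongr
          · linarith
          · linarith
      _ = B * (M : ℝ) ^ (-(σ * (2 ^ k - 2))) * (h * (M : ℝ) ^ (-σ)) := by
          rw [Real.rpow_add hM0]; ring
      _ ≤ _ := by gcongr; exact hq2.trans e1
  have hone : ∀ {x : ℝ}, 0 ≤ x → 1 ≤ (M : ℝ) ^ x := fun hx ↦ Real.one_le_rpow hM' hx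
  have cond2 : 1 ≤ 2 * (M : ℝ) * δ ^ 2 ^ (j + 1) := by
    rw [hpow]
    have e : (M : ℝ) * (M : ℝ) ^ (-(σ * (2 ^ (j + 1) : ℕ))) =
        (M : ℝ) ^ (1 - σ * 2 ^ (j + 1)) := by
      rw [sub_eq_add_neg, Real.rpow_add hM0, Real.rpow_one]; push_cast; rfl
    calc (1 : ℝ) ≤ 2 * (M : ℝ) ^ (1 - σ * 2 ^ (j + 1)) *
          (B ^ 2 ^ (j + 1) * q ^ 2 ^ (j + 1)) := by
          refine one_le_mul_of_one_le_of_one_le ?_ (one_le_mul_of_one_le_of_one_le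
            (one_le_pow₀ hB1) (one_le_pow₀ hq1))
          linarith [hone (sub_nonneg.2 h1)]
      _ = _ := by rw [← e]; ring
  have cond3 : 1 ≤ (2 * (M : ℝ)) ^ k * lam * δ ^ 2 ^ (j + 1) := by
    rw [hpow]
    have e : (M : ℝ) ^ k * (M : ℝ) ^ (α - k) * (M : ℝ) ^ (-(σ * (2 ^ (j + 1) : ℕ))) =
        (M : ℝ) ^ (α - σ * 2 ^ (j + 1)) := by
      rw [← Real.rpow_natCast, ← Real.rpow_add hM0, ← Real.rpow_add hM0]
      push_cast
      ring_nf
    have e2 : 1 ≤ c * B ^ 2 ^ (j + 1) := by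
      calc 1 = c * (1 / c) := by field_simp
        _ ≤ c * B ^ 2 ^ (j + 1) := by
          gcongr
          exact le_trans (by linarith) (hBpow _ hKpos)
    calc (1 : ℝ) ≤ (M : ℝ) ^ (α - σ * 2 ^ (j + 1)) * (2 ^ k * h) *
          ((c * B ^ 2 ^ (j + 1)) * q ^ 2 ^ (j + 1)) := by
          refine one_le_mul_of_one_le_of_one_le (one_le_mul_of_one_le_of_one_le
            (hone (sub_nonneg.2 h3)) (one_le_mul_of_one_le_of_one_le
            (one_le_pow₀ one_le_two) hh')) (one_le_mul_of_one_le_of_one_le e2 (one_le_pow₀ hq1))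
      _ = _ := by rw [← e, hlam, mul_pow]; ring
  obtain ⟨s, hs, hsP⟩ := exists_sign_mul_eq_abs P
  have key := H (fun i ↦ s * (h * ((M : ℝ) + 1 + i) ^ α)) L (2 * M) lam δ (by positivity)
    (by positivity) (by have : (L : ℝ) ≤ M + 1 := by exact_mod_cast hL
                        linarith) cond1 cond2 cond3
    (fun n hn ↦ fwdDiff_iter_rpow_block_mem_Icc hkα hM (by lia) (by positivity) hsP)
  have hnorm : ‖∑ n ∈ Finset.range L, unitExp (s * (h * ((M : ℝ) + 1 + n) ^ α))‖ =
      ‖∑ n ∈ Finset.range L, unitExp (h * ((M : ℝ) + 1 + n) ^ α)‖ := by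
    rcases hs with rfl | rfl
    · simp only [one_mul]
    · simp only [neg_one_mul]
      exact norm_sum_unitExp_neg (fun n ↦ h * ((M : ℝ) + 1 + n) ^ α) L
  rw [hnorm] at key
  calc _ ≤ _ := key
    _ = 2 * C * B * (M : ℝ) ^ (1 - σ) * q := by
        rw [hδ, sub_eq_add_neg, Real.rpow_add hM0, Real.rpow_one]; ring
    _ ≤ _ := by gcongr

theorem abs_sum_fract_rpow_block_le {α σ : ℝ} {j : ℕ} (hαn : ∀ l : ℕ, α ≠ l) (hσ : 0 ≤ σ)
    (h1 : σ * 2 ^ (j + 1) ≤ 1) (h2 : σ * (2 ^ (j + 2) - 1) ≤ (j + 2 : ℕ) - α)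
    (h3 : σ * 2 ^ (j + 1) ≤ α) :
    ∃ C : ℝ, 0 ≤ C ∧ ∀ M L : ℕ, 1 ≤ M → L ≤ M + 1 →
      |∑ n ∈ Finset.range L, (Int.fract (((M : ℝ) + 1 + n) ^ α) - 1 / 2)| ≤
        C * (M : ℝ) ^ (1 - σ) * (1 + log M) := by
  obtain ⟨C, hC, H⟩ := norm_sum_unitExp_rpow_le hαn hσ h1 h2 h3
  refine ⟨2 + 10 * C, by positivity, fun M L hM hL ↦ ?_⟩
  have hM' : (1 : ℝ) ≤ M := by exact_mod_cast hM
  have hM0 : (0 : ℝ) < M := by linarith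
  have hlog : 0 ≤ log M := Real.log_nonneg hM'
  have hσ1 : σ ≤ 1 := (le_mul_of_one_le_right hσ (one_le_pow₀ one_le_two)).trans h1
  have key := abs_sum_fract_sub_half_le (x := fun n : ℕ ↦ ((M : ℝ) + 1 + n) ^ α) (L := L)
    (Real.one_le_rpow hM' hσ) (E := C * (M : ℝ) ^ (1 - σ)) (by positivity)
    (fun h hh ↦ H M L h hM hL hh)
  have hL' : (L : ℝ) / (M : ℝ) ^ σ ≤ 2 * (M : ℝ) ^ (1 - σ) := by
    have : (L : ℝ) ≤ M + 1 := by exact_mod_cast hL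
    rw [Real.rpow_sub hM0, Real.rpow_one, ← mul_div_assoc]
    gcongr
    linarith
  have hX : 0 ≤ (M : ℝ) ^ (1 - σ) := by positivity
  calc _ ≤ _ := key
    _ ≤ 2 * (M : ℝ) ^ (1 - σ) + 10 * (C * (M : ℝ) ^ (1 - σ)) * (1 + log M) := by
        rw [Real.log_rpow hM0]
        gcongr
        exact mul_le_of_le_one_left hlog hσ1
    _ ≤ _ := by nlinarith [mul_nonneg hX hlog]

/-- A bound on dyadic blocks gives a bound on the full partial sums. -/
theorem exists_abs_sum_range_le_of_dyadic {u : ℕ → ℝ} {β C : ℝ} (hβ : 0 < β) (hC : 0 ≤ C)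
    (h : ∀ M L : ℕ, 1 ≤ M → L ≤ M + 1 → |∑ n ∈ Finset.range L, u (M + n)| ≤
      C * (M : ℝ) ^ β * (1 + log M)) :
    ∃ D : ℝ, 0 ≤ D ∧ ∀ N : ℕ, 1 ≤ N →
      |∑ n ∈ Finset.range N, u n| ≤ D * (N : ℝ) ^ β * (1 + log N) := by
  set r : ℝ := (1 / 2) ^ β with hr
  have hr0 : 0 < r := by positivity
  have hr1 : r < 1 := Real.rpow_lt_one (by norm_num) (by norm_num) hβ
  set D : ℝ := |u 0| + C / (1 - r) with hD
  have hC' : 0 ≤ C / (1 - r) := div_nonneg hC (by linarith)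
  have hD0 : 0 ≤ D := by positivity
  have hDC : C ≤ D * (1 - r) := by
    rw [hD, add_mul, div_mul_cancel₀ _ (by linarith)]
    nlinarith [abs_nonneg (u 0)]
  refine ⟨D, hD0, fun N ↦ ?_⟩
  induction N using Nat.strong_induction_on with
  | _ N ih =>
    intro hN
    rcases Nat.lt_or_ge N 2 with hN2 | hN2
    · obtain rfl : N = 1 := by lia
      simp [hD, hC']
    set M := N / 2 with hM
    obtain ⟨L, hL⟩ : ∃ L, N = M + L := ⟨N - M, by lia⟩
    have hM1 : 1 ≤ M := by lia
    have hi := ih M (by lia) hM1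
    have hb := h M L hM1 (by lia)
    have hM0 : (0 : ℝ) < M := by exact_mod_cast hM1
    have hMN : (M : ℝ) ≤ 1 / 2 * N := by
      have : 2 * M ≤ N := by lia
      have : (2 : ℝ) * M ≤ N := by exact_mod_cast this
      linarith
    have hN0 : (0 : ℝ) < N := by linarith
    have hpow : (M : ℝ) ^ β ≤ r * (N : ℝ) ^ β := by
      rw [hr, ← Real.mul_rpow (by norm_num) hN0.le]
      gcongr
    have hlog0 : 0 ≤ log M := Real.log_nonneg (by exact_mod_cast hM1)
    have hlog : log M ≤ log N := Real.log_le_log hM0 (by linarith)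
    have hMβ : (M : ℝ) ^ β ≤ (N : ℝ) ^ β := by gcongr; linarith
    rw [show N = M + L from hL, Finset.sum_range_add, ← hL]
    calc _ ≤ D * (M : ℝ) ^ β * (1 + log M) + C * (M : ℝ) ^ β * (1 + log M) :=
          (abs_add_le _ _).trans (add_le_add hi hb)
      _ ≤ D * (r * (N : ℝ) ^ β) * (1 + log N) + D * (1 - r) * (N : ℝ) ^ β * (1 + log N) := by
          gcongr
      _ = _ := by ring

theorem one_add_log_le {N : ℕ} (hN : 2 ≤ N) : 1 + log N ≤ (1 / log 2 + 1) * log N := by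
  have h2 : 0 < log 2 := Real.log_pos one_lt_two
  have h3 : log 2 ≤ log N := Real.log_le_log two_pos (by exact_mod_cast hN)
  have : 1 ≤ 1 / log 2 * log N := by rw [one_div_mul_eq_div, one_le_div h2]; exact h3
  linarith

/-- A sequence with a positive value and nonpositive limit superior attains its supremum. -/
theorem exists_forall_ge_le_of_tendsto_zero {g : ℕ → ℝ} {a m₀ : ℕ} (hm₀ : a ≤ m₀)
    (hpos : 0 < g m₀) (hlim : ∀ ε > 0, ∀ᶠ m in atTop, g m ≤ ε) :
    ∃ m₁, a ≤ m₁ ∧ 0 < g m₁ ∧ ∀ m, a ≤ m → g m ≤ g m₁ := by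
  obtain ⟨n, hn⟩ := eventually_atTop.1 (hlim _ hpos)
  obtain ⟨m₁, hm₁, hmax⟩ := Finset.exists_max_image (Finset.Icc a (max m₀ n)) g
    ⟨m₀, Finset.mem_Icc.2 ⟨hm₀, le_max_left _ _⟩⟩
  have h0 := hmax m₀ (Finset.mem_Icc.2 ⟨hm₀, le_max_left _ _⟩)
  refine ⟨m₁, (Finset.mem_Icc.1 hm₁).1, hpos.trans_le h0, fun m hm ↦ ?_⟩
  rcases le_or_gt m n with h | h
  · exact hmax m (Finset.mem_Icc.2 ⟨hm, h.trans (le_max_right _ _)⟩)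
  · exact (hn m h.le).trans h0

theorem exists_sSup_min_eq {α σ : ℝ} (hα : 0 < α)
    (hσ : σ = sSup {x : ℝ | ∃ m : ℕ, 2 ≤ m ∧
      x = min ((2 : ℝ) ^ ((1 : ℝ) - (m : ℝ)))
        (min (((m : ℝ) - α) / ((2 : ℝ) ^ m - 1)) ((2 : ℝ) ^ ((1 : ℝ) - (m : ℝ)) * α))}) :
    ∃ j : ℕ, 0 < σ ∧ σ * 2 ^ (j + 1) ≤ 1 ∧ σ * (2 ^ (j + 2) - 1) ≤ (j + 2 : ℕ) - α ∧
      σ * 2 ^ (j + 1) ≤ α := by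
  set g : ℕ → ℝ := fun m ↦ min ((2 : ℝ) ^ ((1 : ℝ) - (m : ℝ)))
    (min (((m : ℝ) - α) / ((2 : ℝ) ^ m - 1)) ((2 : ℝ) ^ ((1 : ℝ) - (m : ℝ)) * α)) with hg
  have htwo : ∀ m : ℕ, (2 : ℝ) ^ ((1 : ℝ) - (m : ℝ)) = 2 / 2 ^ m := fun m ↦ by
    rw [Real.rpow_sub two_pos, Real.rpow_one, Real.rpow_natCast]
  have hden : ∀ m : ℕ, 2 ≤ m → (0 : ℝ) < 2 ^ m - 1 := fun m hm ↦
    sub_pos.2 (one_lt_pow₀ one_lt_two (by lia))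
  have hpos : 0 < g (⌈α⌉₊ + 2) := by
    have h1 : α < (⌈α⌉₊ + 2 : ℕ) := by push_cast; linarith [Nat.le_ceil α]
    exact lt_min (by positivity) (lt_min (div_pos (sub_pos.2 h1) (hden _ (by lia)))
      (by positivity))
  have hlim : ∀ ε > 0, ∀ᶠ m in atTop, g m ≤ ε := fun ε hε ↦ by
    have h0 : Tendsto (fun m : ℕ ↦ (2 : ℝ) / 2 ^ m) atTop (𝓝 0) :=
      tendsto_const_nhds.div_atTop (tendsto_pow_atTop_atTop_of_one_lt one_lt_two)
    filter_upwards [h0.eventually (ge_mem_nhds hε)] with m hm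
    exact (min_le_left _ _).trans ((htwo m).le.trans hm)
  obtain ⟨m, hm, hgm, hmax⟩ :=
    exists_forall_ge_le_of_tendsto_zero (a := 2) (by lia) hpos hlim
  have hσm : σ = g m := by
    rw [hσ]
    refine IsGreatest.csSup_eq ⟨⟨m, hm, rfl⟩, ?_⟩
    rintro x ⟨n, hn, rfl⟩
    exact hmax n hn
  obtain ⟨j, rfl⟩ := Nat.exists_eq_add_of_le' hm
  have hp : (2 : ℝ) ^ (j + 2) = 2 * 2 ^ (j + 1) := by ring
  refine ⟨j, hσm ▸ hgm, ?_, ?_, ?_⟩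
  · have : σ ≤ 2 / 2 ^ (j + 2) := hσm.le.trans ((min_le_left _ _).trans (htwo _).le)
    rw [le_div_iff₀ (by positivity), hp] at this
    linarith
  · have : σ ≤ ((j + 2 : ℕ) - α) / (2 ^ (j + 2) - 1) :=
      hσm.le.trans ((min_le_right _ _).trans (min_le_left _ _))
    rwa [le_div_iff₀ (hden _ hm)] at this
  · have : σ ≤ 2 / 2 ^ (j + 2) * α :=
      hσm.le.trans ((min_le_right _ _).trans ((min_le_right _ _).trans (by rw [htwo])))
    rw [div_mul_eq_mul_div, le_div_iff₀ (by positivity), hp] at this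
    linarith

theorem stmt15 (α : ℝ) (hα : 0 < α) (hαn : ∀ j : ℕ, α ≠ (j : ℝ)) (σ : ℝ)
    (hσ : σ = sSup {x : ℝ | ∃ m : ℕ, 2 ≤ m ∧
      x = min ((2 : ℝ) ^ ((1 : ℝ) - (m : ℝ)))
        (min (((m : ℝ) - α) / ((2 : ℝ) ^ m - 1)) ((2 : ℝ) ^ ((1 : ℝ) - (m : ℝ)) * α))}) :
    σ ∈ Set.Ioo (0 : ℝ) 1 ∧ ∃ C > 0, ∀ N : ℕ, 2 ≤ N →
      |∑ n ∈ Finset.Icc 1 N, (Int.fract ((n : ℝ) ^ α) - 1 / 2)| ≤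
        C * (N : ℝ) ^ (1 - σ) * Real.log N := by
  obtain ⟨j, hσ0, h1, h2, h3⟩ := exists_sSup_min_eq hα hσ
  have hσ1 : σ < 1 := by
    have : (1 : ℝ) < 2 ^ (j + 1) := one_lt_pow₀ one_lt_two (by lia)
    nlinarith
  refine ⟨⟨hσ0, hσ1⟩, ?_⟩
  obtain ⟨C, hC, hblock⟩ := abs_sum_fract_rpow_block_le hαn hσ0.le h1 h2 h3
  obtain ⟨D, hD, hsum⟩ := exists_abs_sum_range_le_of_dyadic
    (u := fun n : ℕ ↦ Int.fract (((n + 1 : ℕ) : ℝ) ^ α) - 1 / 2) (sub_pos.2 hσ1) hC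
    fun M L hM hL ↦ by
      have := hblock M L hM hL
      simpa only [Nat.cast_add, Nat.cast_one, add_right_comm (M : ℝ) 1] using this
  have hlog2 : 0 < log 2 := Real.log_pos one_lt_two
  refine ⟨(D + 1) * (1 / log 2 + 1), by positivity, fun N hN ↦ ?_⟩
  have hlogN : 0 ≤ log N := Real.log_natCast_nonneg N
  have e : ∑ n ∈ Finset.Icc 1 N, (Int.fract ((n : ℝ) ^ α) - 1 / 2) =
      ∑ n ∈ Finset.range N, (Int.fract (((n + 1 : ℕ) : ℝ) ^ α) - 1 / 2) := by
    rw [Finset.range_eq_Ico, Finset.sum_Ico_add' (fun n : ℕ ↦ Int.fract ((n : ℝ) ^ α) - 1 / 2)]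
    rfl
  rw [e]
  calc _ ≤ D * (N : ℝ) ^ (1 - σ) * (1 + log N) := hsum N (by lia)
    _ ≤ (D + 1) * (N : ℝ) ^ (1 - σ) * ((1 / log 2 + 1) * log N) := by
        gcongr
        · linarith
        · exact one_add_log_le hN
    _ = _ := by ring
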